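/- Let k, n ≥ 1, let ρ : ℤᵏ → GLₙ(ℚ) be a group homomorphism, and let B ≤ ℚⁿ be a subgroup which spans ℚⁿ over ℚ and satisfies ρ(q)(B) = B for every q ∈ ℤᵏ. Form the semidirect product G = B ⋊_ρ ℤᵏ and suppose G is generated by a finite set X. Then there exist constants M ≥ 1 and C ≥ 0 such that for every b ∈ B one has ln(μ_E(b)+1) ≤ M·‖b‖_X + C, where b is viewed as the element (b,0) of G. -/

import Mathlib

/-- For a rational number `β = γ/α` in lowest terms, `μ(β) = |γ|·α`. -/
noncomputable def mu (q : ℚ) : ℝ := (q.num.natAbs * q.den : ℕ)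

/-- `μ_E` of a vector of `ℚⁿ`, coordinates in the standard basis. -/
noncomputable def muE {n : ℕ} (b : Fin n → ℚ) : ℝ := ∑ i, mu (b i)

/-- Word length of `g` with respect to a generating set `X`: the least `m` such that
`g` is a product of `m` elements of `X ∪ X⁻¹`. -/
noncomputable def wordLength {G : Type*} [Group G] (X : Set G) (g : G) : ℕ :=
  sInf {m | ∃ l : List G, (∀ x ∈ l, x ∈ X ∪ X⁻¹) ∧ l.length = m ∧ l.prod = g}

/-- A finite set of rationals has a common denominator which also bounds absolute values. -/
theorem exists_common_den_bound {S : Set ℚ} (hS : S.Finite) :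
    ∃ N : ℕ, 1 ≤ N ∧ ∀ s ∈ S, (∃ z : ℤ, (N : ℚ) * s = z) ∧ |s| ≤ N := by
  refine ⟨∏ s ∈ hS.toFinset, s.den * (s.num.natAbs + 1), ?_, fun s hs => ?_⟩
  · exact Nat.one_le_iff_ne_zero.2 (Finset.prod_ne_zero_iff.2 fun s _ => by
      simp)
  obtain ⟨c, hc⟩ : s.den * (s.num.natAbs + 1) ∣
      ∏ s ∈ hS.toFinset, s.den * (s.num.natAbs + 1) :=
    Finset.dvd_prod_of_mem (fun s : ℚ => s.den * (s.num.natAbs + 1)) (hS.mem_toFinset.2 hs)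
  have hpos : 1 ≤ ∏ s ∈ hS.toFinset, s.den * (s.num.natAbs + 1) :=
    Nat.one_le_iff_ne_zero.2 (Finset.prod_ne_zero_iff.2 fun s _ => by simp)
  rw [hc] at hpos ⊢
  have hs_den : s * s.den = s.num := Rat.mul_den_eq_num s
  have hden : (1 : ℚ) ≤ s.den := by exact_mod_cast s.den_pos
  refine ⟨⟨s.num * ((s.num.natAbs + 1 : ℕ) : ℤ) * c, ?_⟩, ?_⟩
  · rw [Int.cast_mul, Int.cast_mul, Int.cast_natCast, Int.cast_natCast, ← hs_den]
    push_cast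
    ring
  · have hcpos : 1 ≤ c := Nat.pos_of_mul_pos_left hpos
    have h1 : |s| ≤ (s.num.natAbs : ℚ) := by
      have : |s| * s.den = (s.num.natAbs : ℚ) := by
        rw [Nat.cast_natAbs, Int.cast_abs, ← hs_den, abs_mul, Nat.abs_cast]
      nlinarith [abs_nonneg s]
    have h2 : s.num.natAbs ≤ s.den * (s.num.natAbs + 1) * c := by
      have := s.den_pos
      calc s.num.natAbs ≤ 1 * (s.num.natAbs + 1) * 1 := by omega
        _ ≤ _ := by gcongr; omega
    exact h1.trans (by exact_mod_cast h2)

/-- A bound on `mu` in terms of a denominator and the absolute value. -/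
theorem mu_le_of_mul_eq_int {v : ℚ} {N : ℕ} (hN : 1 ≤ N) {z : ℤ} (hz : (N : ℚ) * v = z) {K : ℚ}
    (hK : |v| ≤ K) : mu v ≤ K * (N : ℝ) ^ 2 := by
  have hN0 : (N : ℚ) ≠ 0 := by positivity
  have hv : v = Rat.divInt z N := by
    rw [Rat.divInt_eq_div, ← hz, Int.cast_natCast]
    field_simp
  have hdvd : v.den ∣ N := by
    have := Rat.den_dvd z N
    rw [← hv] at this
    exact_mod_cast this
  have hle : (v.den : ℚ) ≤ N := by exact_mod_cast Nat.le_of_dvd hN hdvd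
  have hnum : (v.num.natAbs : ℚ) = |v| * v.den := by
    rw [Nat.cast_natAbs, Int.cast_abs, ← Rat.mul_den_eq_num v, abs_mul, Nat.abs_cast]
  have key : ((v.num.natAbs * v.den : ℕ) : ℚ) ≤ K * (N : ℚ) ^ 2 := by
    have hK0 : 0 ≤ K := (abs_nonneg v).trans hK
    push_cast
    rw [hnum, mul_assoc, ← sq]
    gcongr
  unfold mu
  exact_mod_cast key

/-- Word length is realised by a word in the generators and their inverses. -/
theorem exists_list_length_eq_wordLength {G : Type*} [Group G] {X : Set G}
    (hX : Subgroup.closure X = ⊤) (g : G) :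
    ∃ l : List G, (∀ x ∈ l, x ∈ X ∪ X⁻¹) ∧ l.length = wordLength X g ∧ l.prod = g := by
  have hne : {m | ∃ l : List G, (∀ x ∈ l, x ∈ X ∪ X⁻¹) ∧ l.length = m ∧ l.prod = g}.Nonempty := by
    have hg : g ∈ Submonoid.closure (X ∪ X⁻¹) := by
      rw [← Subgroup.closure_toSubmonoid, hX]
      trivial
    obtain ⟨l, hl, hprod⟩ := Submonoid.exists_list_of_mem_closure hg
    exact ⟨l.length, l, hl, rfl, hprod⟩
  exact Nat.sInf_mem hne

/-- One step of an affine iteration multiplies denominators by `N` and sizes by `(n + 1) * N`. -/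
theorem affine_step_bound {n N m : ℕ} (hN : 1 ≤ N) {A : Matrix (Fin n) (Fin n) ℚ}
    {u v : Fin n → ℚ}
    (hA : ∀ i j, (∃ z : ℤ, (N : ℚ) * A i j = z) ∧ |A i j| ≤ N)
    (hu : ∀ i, (∃ z : ℤ, (N : ℚ) * u i = z) ∧ |u i| ≤ N)
    (hv : ∀ i, (∃ z : ℤ, ((N ^ m : ℕ) : ℚ) * v i = z) ∧ |v i| ≤ (((n + 1) * N) ^ m : ℕ))
    (i : Fin n) :
    (∃ z : ℤ, ((N ^ (m + 1) : ℕ) : ℚ) * (u + A.mulVec v) i = z) ∧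
      |(u + A.mulVec v) i| ≤ (((n + 1) * N) ^ (m + 1) : ℕ) := by
  have happ : (u + A.mulVec v) i = u i + ∑ j, A i j * v j := rfl
  rw [happ]
  constructor
  · obtain ⟨a, ha⟩ := (hu i).1
    choose b hb using fun j => (hA i j).1
    choose c hc using fun j => (hv j).1
    refine ⟨N ^ m * a + ∑ j, b j * c j, ?_⟩
    push_cast
    rw [← ha, mul_add, Finset.mul_sum]
    congr 1
    · ring
    · refine Finset.sum_congr rfl fun j _ => ?_
      rw [← hb, ← hc]
      push_cast
      ring
  · have hone : (1 : ℚ) ≤ (((n + 1) * N) ^ m : ℕ) := by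
      exact_mod_cast Nat.one_le_pow _ _ (by positivity)
    calc |u i + ∑ j, A i j * v j| ≤ |u i| + ∑ j, |A i j * v j| :=
          (abs_add_le _ _).trans (by gcongr; exact Finset.abs_sum_le_sum_abs _ _)
      _ ≤ N * (((n + 1) * N) ^ m : ℕ) + ∑ _j : Fin n, (N : ℚ) * (((n + 1) * N) ^ m : ℕ) := by
          gcongr with j
          · exact (hu i).2.trans (le_mul_of_one_le_right (by positivity) hone)
          · rw [abs_mul]
            exact mul_le_mul (hA i j).2 (hv j).2 (abs_nonneg _) (by positivity)
      _ = (((n + 1) * N) ^ (m + 1) : ℕ) := by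
          simp only [Finset.sum_const, Finset.card_univ, Fintype.card_fin, nsmul_eq_mul]
          push_cast
          ring

theorem stmt_4 (k n : ℕ) (hk : 1 ≤ k) (hn : 1 ≤ n)
    (ρ : Multiplicative (Fin k → ℤ) →* Matrix.GeneralLinearGroup (Fin n) ℚ)
    (B : AddSubgroup (Fin n → ℚ))
    (hBspan : Submodule.span ℚ (B : Set (Fin n → ℚ)) = ⊤)
    (hBinv : ∀ q : Multiplicative (Fin k → ℤ),
      B.map (Matrix.mulVecLin (ρ q : Matrix (Fin n) (Fin n) ℚ)).toAddMonoidHom = B)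
    (φ : Multiplicative (Fin k → ℤ) →* MulAut (Multiplicative B))
    -- `φ` implements the action `ρ` on `B`
    (hφ : ∀ (q : Multiplicative (Fin k → ℤ)) (b : B),
      ((Multiplicative.toAdd ((φ q) (Multiplicative.ofAdd b)) : B) : Fin n → ℚ) =
        Matrix.mulVec (ρ q : Matrix (Fin n) (Fin n) ℚ) (b : Fin n → ℚ))
    (X : Set (SemidirectProduct (Multiplicative B) (Multiplicative (Fin k → ℤ)) φ))
    (hXfin : X.Finite) (hXgen : Subgroup.closure X = ⊤) :
    ∃ M C : ℝ, 1 ≤ M ∧ 0 ≤ C ∧ ∀ b : B,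
      Real.log (muE (b : Fin n → ℚ) + 1) ≤
        M * (wordLength X (SemidirectProduct.inl (Multiplicative.ofAdd b)) : ℝ) + C := by
  have hY : (X ∪ X⁻¹).Finite := hXfin.union hXfin.inv
  obtain ⟨N, hN, hbound⟩ := exists_common_den_bound
    (S := (⋃ x ∈ X ∪ X⁻¹, Set.range fun i => (x.left.toAdd : Fin n → ℚ) i) ∪
      ⋃ x ∈ X ∪ X⁻¹, Set.range fun p : Fin n × Fin n =>
        (ρ x.right : Matrix (Fin n) (Fin n) ℚ) p.1 p.2)
    ((hY.biUnion fun _ _ => Set.finite_range _).union (hY.biUnion fun _ _ => Set.finite_range _))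
  have hword : ∀ l : List (SemidirectProduct (Multiplicative B) (Multiplicative (Fin k → ℤ)) φ),
      (∀ x ∈ l, x ∈ X ∪ X⁻¹) → ∀ i,
        (∃ z : ℤ, ((N ^ l.length : ℕ) : ℚ) * (l.prod.left.toAdd : Fin n → ℚ) i = z) ∧
          |(l.prod.left.toAdd : Fin n → ℚ) i| ≤ (((n + 1) * N) ^ l.length : ℕ) := by
    intro l
    induction l with
    | nil => exact fun _ i => ⟨⟨0, by simp⟩, by simp⟩
    | cons x l ih =>
      intro hl
      have hx : x ∈ X ∪ X⁻¹ := hl x List.mem_cons_self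
      have hleft : (((x :: l).prod.left.toAdd : B) : Fin n → ℚ) =
          (x.left.toAdd : Fin n → ℚ) +
            (ρ x.right : Matrix (Fin n) (Fin n) ℚ).mulVec (l.prod.left.toAdd : Fin n → ℚ) := by
        rw [← hφ, List.prod_cons, SemidirectProduct.mul_left]
        rfl
      rw [hleft]
      exact affine_step_bound hN
        (fun i j => hbound _ (Or.inr (Set.mem_biUnion hx ⟨(i, j), rfl⟩)))
        (fun i => hbound _ (Or.inl (Set.mem_biUnion hx ⟨i, rfl⟩)))
        (ih fun y hy => hl y (List.mem_cons_of_mem _ hy))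
  set L : ℝ := ((n + 1) * N) * N ^ 2 with hL
  have hN' : (1 : ℝ) ≤ N := by exact_mod_cast hN
  have hL1 : 1 ≤ L := by
    have h1 : (1 : ℝ) ≤ (n + 1) * N := by
      exact_mod_cast Nat.one_le_iff_ne_zero.2 (by positivity)
    exact one_le_mul_of_one_le_of_one_le h1 (one_le_pow₀ hN')
  refine ⟨max 1 (Real.log L), Real.log (n + 1), le_max_left _ _,
    Real.log_nonneg (by simp), fun b => ?_⟩
  obtain ⟨l, hl, hlen, hprod⟩ := exists_list_length_eq_wordLength hXgen
    (SemidirectProduct.inl (φ := φ) (Multiplicative.ofAdd b))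
  rw [← hlen]
  have hb := hword l hl
  rw [hprod] at hb
  have hmu : ∀ i, mu ((b : Fin n → ℚ) i) ≤ L ^ l.length := fun i => by
    obtain ⟨⟨z, hz⟩, hle⟩ := hb i
    refine (mu_le_of_mul_eq_int (Nat.one_le_pow _ _ hN) hz hle).trans_eq ?_
    push_cast
    rw [hL]
    simp only [mul_pow]
    ring
  have hsum : muE (b : Fin n → ℚ) + 1 ≤ (n + 1) * L ^ l.length := by
    have h1 : muE (b : Fin n → ℚ) ≤ n * L ^ l.length := by
      simpa [muE] using Finset.sum_le_card_nsmul Finset.univ _ _ fun i _ => hmu i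
    linarith [one_le_pow₀ hL1 (n := l.length)]
  have hpos : 0 < muE (b : Fin n → ℚ) + 1 := by
    have : 0 ≤ muE (b : Fin n → ℚ) := Finset.sum_nonneg fun i _ => Nat.cast_nonneg _
    linarith
  calc Real.log (muE (b : Fin n → ℚ) + 1) ≤ Real.log ((n + 1) * L ^ l.length) :=
        Real.log_le_log hpos hsum
    _ = Real.log L * l.length + Real.log (n + 1) := by
        rw [Real.log_mul (by positivity) (by positivity), Real.log_pow]
        ring
    _ ≤ _ := by
        gcongr
        exact le_max_right _ _
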